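/- Let X be a connected uniformly locally finite graph. The following are equivalent: (1) there exists R such that every circuit of X is the sum of a locally finite family of circuits of length ≤ R (X has no ℤ₂-large circuits); (2) for every locally finite family (f_i)_{i∈ℕ} of elements of 𝒞_∞(X,ℤ₂), the pointwise sum Σ_i f_i belongs to 𝒞_∞(X,ℤ₂) (the infinite sum of zero classes in H^uf_1(X,ℤ₂) is consistent); (3) whenever (x_i)_{i∈ℕ} and (y_i)_{i∈ℕ} are locally finite families in Z^suf_1(X,ℤ₂) with x_i + y_i ∈ 𝒞_∞(X,ℤ₂) for every i, then Σ_i x_i + Σ_i y_i ∈ 𝒞_∞(X,ℤ₂) (every sum of homology classes admitting a thin family of representatives is consistent). -/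

import Mathlib

open scoped Classical

namespace UFH

variable {V : Type}

/-- Uniform local finiteness: a uniform bound on vertex degrees. -/
def ULF (G : SimpleGraph V) : Prop :=
  ∃ D : ℕ, ∀ v : V, (G.neighborSet v).Finite ∧ (G.neighborSet v).ncard ≤ D

/-- An integer 1-chain: antisymmetric and supported on adjacent pairs. -/
def IsChain1 (G : SimpleGraph V) (f : V → V → ℤ) : Prop :=
  (∀ u v, f u v = - f v u) ∧ ∀ u v, f u v ≠ 0 → G.Adj u v

/-- A mod-2 1-chain: symmetric and supported on adjacent pairs. -/
def IsChain1Z2 (G : SimpleGraph V) (f : V → V → ZMod 2) : Prop :=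
  (∀ u v, f u v = f v u) ∧ ∀ u v, f u v ≠ 0 → G.Adj u v

/-- Divergence of an integer 1-chain at a vertex. -/
noncomputable def chainDiv (f : V → V → ℤ) (v : V) : ℤ := ∑ᶠ u, f u v

/-- Divergence of a mod-2 1-chain at a vertex. -/
noncomputable def chainDivZ2 (f : V → V → ZMod 2) (v : V) : ZMod 2 := ∑ᶠ u, f u v

def Bdd (f : V → V → ℤ) (C : ℕ) : Prop := ∀ u v, |f u v| ≤ (C : ℤ)

/-- The sup-norm of a bounded integer 1-chain (least uniform bound). -/
noncomputable def chainNorm (f : V → V → ℤ) : ℕ := sInf {C : ℕ | Bdd f C}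

/-- Bounded integer flows: bounded 1-chains with vanishing divergence everywhere. -/
def Zsuf1 (G : SimpleGraph V) : Set (V → V → ℤ) :=
  {f | IsChain1 G f ∧ (∃ C, Bdd f C) ∧ ∀ v, chainDiv f v = 0}

/-- Mod-2 cycles: mod-2 1-chains whose support meets every vertex evenly. -/
def Zsuf1Z2 (G : SimpleGraph V) : Set (V → V → ZMod 2) :=
  {f | IsChain1Z2 G f ∧ ∀ v, chainDivZ2 f v = 0}

/-- A circuit: a closed walk (based at some vertex). -/
abbrev Circuit (G : SimpleGraph V) := Σ v : V, G.Walk v v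

/-- Number of traversals of the oriented edge `(a, b)` by the walk `p`. -/
noncomputable def traversals {G : SimpleGraph V} {u v : V} (p : G.Walk u v) (a b : V) : ℕ :=
  ((Finset.range p.length).filter fun i => p.getVert i = a ∧ p.getVert (i + 1) = b).card

/-- The integer 1-chain of signed traversals of a walk. -/
noncomputable def walkChain {G : SimpleGraph V} {u v : V} (p : G.Walk u v) (a b : V) : ℤ :=
  (traversals p a b : ℤ) - (traversals p b a : ℤ)

/-- The mod-2 1-chain of traversals of a walk. -/
noncomputable def walkChainZ2 {G : SimpleGraph V} {u v : V} (p : G.Walk u v) (a b : V) : ZMod 2 :=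
  (traversals p a b : ZMod 2) + (traversals p b a : ZMod 2)

/-- The walk `p` passes through the edge `{a, b}`. -/
def OnWalk {G : SimpleGraph V} {u v : V} (p : G.Walk u v) (a b : V) : Prop :=
  ∃ i < p.length, (p.getVert i = a ∧ p.getVert (i + 1) = b) ∨
    (p.getVert i = b ∧ p.getVert (i + 1) = a)

/-- A coefficient family on circuits is thin (locally finite). -/
def ThinCoef (G : SimpleGraph V) (g : Circuit G → ℤ) : Prop :=
  ∀ a b : V, {c : Circuit G | g c ≠ 0 ∧ OnWalk c.2 a b}.Finite

def ThinCoefZ2 (G : SimpleGraph V) (g : Circuit G → ZMod 2) : Prop :=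
  ∀ a b : V, {c : Circuit G | g c ≠ 0 ∧ OnWalk c.2 a b}.Finite

/-- The 1-chain obtained as the (pointwise) sum of a family of circuits with coefficients. -/
noncomputable def circSum (G : SimpleGraph V) (g : Circuit G → ℤ) : V → V → ℤ :=
  fun a b => ∑ᶠ c : Circuit G, g c * walkChain c.2 a b

noncomputable def circSumZ2 (G : SimpleGraph V) (g : Circuit G → ZMod 2) : V → V → ZMod 2 :=
  fun a b => ∑ᶠ c : Circuit G, g c * walkChainZ2 c.2 a b

/-- 𝒞_r(X, ℤ): sums of circuits of length ≤ r with uniformly bounded integer coefficients. -/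
def Cr (G : SimpleGraph V) (r : ℕ) : Set (V → V → ℤ) :=
  {f | ∃ g : Circuit G → ℤ, (∃ C : ℕ, ∀ c, |g c| ≤ (C : ℤ)) ∧
    (∀ c, g c ≠ 0 → c.2.length ≤ r) ∧ ThinCoef G g ∧ f = circSum G g}

/-- 𝒞_∞(X, ℤ). -/
def Cinf (G : SimpleGraph V) : Set (V → V → ℤ) := ⋃ r : ℕ, Cr G r

/-- 𝒞(X, ℤ): thin sums of circuits with integer coefficients whose result is bounded. -/
def Cthin (G : SimpleGraph V) : Set (V → V → ℤ) :=
  {f | ∃ g : Circuit G → ℤ, ThinCoef G g ∧ (∃ C, Bdd f C) ∧ f = circSum G g}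

/-- 𝒞_r(X, ℤ₂). -/
def CrZ2 (G : SimpleGraph V) (r : ℕ) : Set (V → V → ZMod 2) :=
  {f | ∃ g : Circuit G → ZMod 2, (∀ c, g c ≠ 0 → c.2.length ≤ r) ∧
    ThinCoefZ2 G g ∧ f = circSumZ2 G g}

/-- 𝒞_∞(X, ℤ₂). -/
def CinfZ2 (G : SimpleGraph V) : Set (V → V → ZMod 2) := ⋃ r : ℕ, CrZ2 G r

/-- 𝒞(X, ℤ₂): thin sums of circuits mod 2. -/
def CthinZ2 (G : SimpleGraph V) : Set (V → V → ZMod 2) :=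
  {f | ∃ g : Circuit G → ZMod 2, ThinCoefZ2 G g ∧ f = circSumZ2 G g}

/-- `a` and `b` are joined by a walk avoiding the set `K`. -/
def ConnAvoiding (G : SimpleGraph V) (K : Set V) (a b : V) : Prop :=
  ∃ p : G.Walk a b, ∀ v ∈ p.support, v ∉ K

/-- A (one-sided infinite) ray in `G`. -/
def IsRay (G : SimpleGraph V) (x : ℕ → V) : Prop :=
  Function.Injective x ∧ ∀ n, G.Adj (x n) (x (n + 1))

/-- Two rays determine the same end. -/
def RayEquiv (G : SimpleGraph V) (x y : ℕ → V) : Prop :=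
  ∀ K : Finset V, ∃ N, ∀ n, N ≤ n → ∀ m, N ≤ m → ConnAvoiding G (↑K) (x n) (y m)

/-- The connected component of `v` in `X − K`. -/
def Component (G : SimpleGraph V) (K : Set V) (v : V) : Set V :=
  {u | u ∉ K ∧ ConnAvoiding G K u v}

def MoreThanOneEnd (G : SimpleGraph V) : Prop :=
  ∃ K : Finset V, ∃ v w : V, v ∉ K ∧ w ∉ K ∧ (Component G (↑K) v).Infinite ∧
    (Component G (↑K) w).Infinite ∧ ¬ ConnAvoiding G (↑K) v w

def OneEnded (G : SimpleGraph V) : Prop :=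
  Infinite V ∧ ∀ K : Finset V, ∃ v, v ∉ K ∧ (Component G (↑K) v).Infinite ∧
    ∀ u, u ∉ K → (Component G (↑K) u).Infinite → ConnAvoiding G (↑K) u v

/-- A bip: a bi-infinite path, i.e. injective graph morphism ℤ → T. -/
def IsBip (T : SimpleGraph V) (b : ℤ → V) : Prop :=
  Function.Injective b ∧ ∀ n : ℤ, T.Adj (b n) (b (n + 1))

/-- The bip `b` lies over the edge `{u, v}`. -/
def LiesOver (b : ℤ → V) (u v : V) : Prop :=
  ∃ n : ℤ, (b n = u ∧ b (n + 1) = v) ∨ (b n = v ∧ b (n + 1) = u)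

/-- The signed traversal of the oriented edge `(u, v)` by the bip `b`. -/
noncomputable def bipSign (b : ℤ → V) (u v : V) : ℤ :=
  if ∃ n : ℤ, b n = u ∧ b (n + 1) = v then 1
  else if ∃ n : ℤ, b n = v ∧ b (n + 1) = u then -1 else 0

noncomputable def bipOverZ2 (b : ℤ → V) (u v : V) : ZMod 2 :=
  if LiesOver b u v then 1 else 0

/-- `p` is the last bip of `P` (w.r.t. the order `r`) lying over the edge `{u, v}`. -/
def IsLast (P : Set (ℤ → V)) (r : (ℤ → V) → (ℤ → V) → Prop) (p : ℤ → V) (u v : V) : Prop :=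
  LiesOver p u v ∧ ∀ q ∈ P, q ≠ p → LiesOver q u v → r q p

/-- The 1-chain associated to coefficients on a family of bips. -/
noncomputable def bipMap (P : Set (ℤ → V)) (f : ↥P → ℤ) : V → V → ℤ :=
  fun u v => ∑ᶠ p : ↥P, f p * bipSign p.1 u v

noncomputable def bipMapZ2 (P : Set (ℤ → V)) (f : ↥P → ZMod 2) : V → V → ZMod 2 :=
  fun u v => ∑ᶠ p : ↥P, f p * bipOverZ2 p.1 u v

/-- The set `S` is connected in the graph `H` (walks staying inside `S`). -/
def ConnectedIn (H : SimpleGraph V) (S : Set V) : Prop :=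
  ∀ a ∈ S, ∀ b ∈ S, ∃ p : H.Walk a b, ∀ v ∈ p.support, v ∈ S

/-- `T` is a subtree of `G`. -/
def IsSubtree (G T : SimpleGraph V) : Prop :=
  T ≤ G ∧ T.IsAcyclic ∧ T.support.Nonempty ∧ ConnectedIn T T.support

/-- Every vertex of `T` has degree ≥ 2 in `T`. -/
def Leafless (T : SimpleGraph V) : Prop :=
  ∀ v ∈ T.support, ∃ u w : V, u ≠ w ∧ T.Adj v u ∧ T.Adj v w

/-- Distinct ends of `T` determine distinct ends of `G`. -/
def EndRespecting (G T : SimpleGraph V) : Prop :=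
  ∀ x y : ℕ → V, IsRay T x → IsRay T y → RayEquiv G x y → RayEquiv T x y

/-- Every end of `G` is represented by a unique end of `T`. -/
def EndDefining (G T : SimpleGraph V) : Prop :=
  EndRespecting G T ∧ ∀ x : ℕ → V, IsRay G x → ∃ y : ℕ → V, IsRay T y ∧ RayEquiv G x y

/-- The subtree `T` of `G` has separators. -/
def HasSeparators (G T : SimpleGraph V) : Prop :=
  ∃ K : ℕ → Finset V,
    (∀ n, K n ⊆ K (n + 1)) ∧
    (∀ v : V, ∃ n, v ∈ K n) ∧
    (∀ n, ConnectedIn G (↑(K n))) ∧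
    (∀ n, ConnectedIn T (T.support ∩ ↑(K n))) ∧
    (∀ n, ∀ v : V, v ∉ K n → (Component G (↑(K n)) v).Infinite →
      ∃! e : V × V, T.Adj e.1 e.2 ∧ e.1 ∈ K n ∧ e.2 ∉ K n ∧
        e.2 ∈ Component G (↑(K n)) v) ∧
    (∀ n, ∀ a b : V, T.Adj a b → a ∈ K n → b ∉ K n → (Component G (↑(K n)) b).Infinite)

/-- An integer 2-chain: alternating, supported on triangles. -/
def IsChain2 (G : SimpleGraph V) (g : V → V → V → ℤ) : Prop :=
  (∀ u v w, g u v w = - g v u w) ∧ (∀ u v w, g u v w = - g u w v) ∧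
    ∀ u v w, g u v w ≠ 0 → G.Adj u v ∧ G.Adj v w ∧ G.Adj u w

def Bdd2 (g : V → V → V → ℤ) (C : ℕ) : Prop := ∀ u v w, |g u v w| ≤ (C : ℤ)

/-- The boundary of a 2-chain. -/
noncomputable def bd2 (g : V → V → V → ℤ) : V → V → ℤ := fun u v => ∑ᶠ w, g u v w

/-- `H^suf_1`-expansion. -/
def HsufExp1 (G : SimpleGraph V) : Prop :=
  ∃ K : ℕ → ℕ, ∀ U : Finset V, ∀ f : V → V → ℤ,
    IsChain1 G f →
    (∀ u v, f u v ≠ 0 → u ∈ U ∧ v ∈ U) →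
    (∀ v ∈ U, (∀ u, G.Adj u v → u ∈ U) → chainDiv f v = 0) →
    (∃ fh ∈ Zsuf1 G, (∀ u ∈ U, ∀ v ∈ U, fh u v = f u v) ∧ chainNorm fh = chainNorm f) →
    ∃ g : V → V → V → ℤ, IsChain2 G g ∧ Bdd2 g (K (chainNorm f)) ∧
      ∀ u ∈ U, ∀ v ∈ U, bd2 g u v = f u v

/-- Pure `H^suf_1`-expansion. -/
def PureHsufExp1 (G : SimpleGraph V) : Prop :=
  ∃ K : ℕ → ℕ, ∀ U : Finset V, ∀ f : V → V → ℤ,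
    IsChain1 G f →
    (∀ u v, f u v ≠ 0 → u ∈ U ∧ v ∈ U) →
    (∀ v ∈ U, (∀ u, G.Adj u v → u ∈ U) → chainDiv f v = 0) →
    (∃ fh : V → V → ℤ, IsChain1 G fh ∧
        (∃ g2 : V → V → V → ℤ, IsChain2 G g2 ∧ (∃ C, Bdd2 g2 C) ∧ bd2 g2 = fh) ∧
        (∀ u ∈ U, ∀ v ∈ U, fh u v = f u v) ∧ chainNorm fh = chainNorm f) →
    ∃ g : V → V → V → ℤ, IsChain2 G g ∧ Bdd2 g (K (chainNorm f)) ∧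
      ∀ u ∈ U, ∀ v ∈ U, bd2 g u v = f u v

/-- The Rips graph of radius `s`. -/
def rips (G : SimpleGraph V) (s : ℕ) : SimpleGraph V :=
  SimpleGraph.fromRel fun u v => G.dist u v ≤ s

/-- Pure `H^uf_1`-expansion: the Rips graphs eventually have pure `H^suf_1`-expansion. -/
def PureHufExp1 (G : SimpleGraph V) : Prop := ∃ s₀ : ℕ, ∀ s, s₀ ≤ s → PureHsufExp1 (rips G s)

def VertexTransitive (G : SimpleGraph V) : Prop := ∀ u v : V, ∃ φ : G ≃g G, φ u = v

/-- The edge boundary of a finite set of vertices. -/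
def edgeBoundary (G : SimpleGraph V) (U : Finset V) : Set (Sym2 V) :=
  {e | e ∈ G.edgeSet ∧ ∃ a b : V, e = s(a, b) ∧ a ∈ U ∧ b ∉ U}

/-- Mod-2 reduction of an integer 1-chain. -/
def mod2 (f : V → V → ℤ) : V → V → ZMod 2 := fun u v => ((f u v : ℤ) : ZMod 2)

/-- Pointwise domination of 1-chains: `r` flows in the same direction as `φ`, no stronger. -/
def chainLE (r φ : V → V → ℤ) : Prop :=
  ∀ u v, (0 ≤ φ u v → 0 ≤ r u v ∧ r u v ≤ φ u v) ∧ (φ u v ≤ 0 → φ u v ≤ r u v ∧ r u v ≤ 0)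

/-- A set of functions is locally finite (thin). -/
def ThinFamily {Y : Type} (F : Set (Y → ZMod 2)) : Prop := ∀ y : Y, {f ∈ F | f y ≠ 0}.Finite

/-- The pointwise sum of a (thin) set of functions. -/
noncomputable def thinSum {Y : Type} (F : Set (Y → ZMod 2)) : Y → ZMod 2 :=
  fun y => ∑ᶠ f : ↥F, f.1 y

/-- A thin-sum space: a subspace closed under thin sums. -/
def IsThinSumSpace {Y : Type} (W : Set (Y → ZMod 2)) : Prop :=
  0 ∈ W ∧ (∀ f ∈ W, ∀ g ∈ W, f + g ∈ W) ∧ ∀ F ⊆ W, ThinFamily F → thinSum F ∈ W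

/-- A thin-sum basis for a thin-sum space. -/
def IsThinSumBasis {Y : Type} (A W : Set (Y → ZMod 2)) : Prop :=
  A ⊆ W ∧ (∀ f ∈ W, ∃ F ⊆ A, ThinFamily F ∧ f = thinSum F) ∧
    ∀ F ⊆ A, ThinFamily F → F.Nonempty → thinSum F ≠ 0

open Filter Topology

section Topological

/-- The pointwise sum of a locally finite family in a closed subgroup lies in that subgroup. -/
theorem finsum_mem_of_isClosed {ι : Type*} {H : AddSubgroup (V → V → ZMod 2)}
    (hH : IsClosed (H : Set (V → V → ZMod 2))) (F : ι → V → V → ZMod 2) (hF : ∀ i, F i ∈ H)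
    (hfin : ∀ a b, {i | F i a b ≠ 0}.Finite) : (fun a b => ∑ᶠ i, F i a b) ∈ H := by
  refine hH.mem_of_tendsto (f := fun s : Finset ι => ∑ i ∈ s, F i) (b := atTop) ?_
    (Eventually.of_forall fun s => H.sum_mem fun i _ => hF i)
  refine tendsto_pi_nhds.2 fun a => tendsto_pi_nhds.2 fun b => ?_
  refine tendsto_const_nhds.congr' ?_
  filter_upwards [eventually_ge_atTop (hfin a b).toFinset] with s hs
  rw [Finset.sum_apply, Finset.sum_apply]
  exact finsum_eq_sum_of_support_subset _ fun i hi => hs ((hfin a b).mem_toFinset.2 hi)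

/-- In a compact group, an exhausting increasing sequence of closed subgroups stabilises. -/
theorem exists_eq_top_of_isClosed_of_monotone {A : Type*} [AddCommGroup A] [TopologicalSpace A]
    [IsTopologicalAddGroup A] [CompactSpace A] [T2Space A] (H : ℕ → AddSubgroup A)
    (hmono : Monotone H) (hclosed : ∀ n, IsClosed (H n : Set A)) (hU : ∀ x, ∃ n, x ∈ H n) :
    ∃ n, H n = ⊤ := by
  obtain ⟨n, x, hx⟩ := nonempty_interior_of_iUnion_of_closed hclosed
    (Set.eq_univ_of_forall fun x => Set.mem_iUnion.2 (hU x))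
  have hopen : ∀ m, IsOpen (H (max n m) : Set A) := fun m =>
    (H (max n m)).isOpen_of_mem_nhds (g := x)
      (mem_of_superset (mem_interior_iff_mem_nhds.1 hx) (hmono (le_max_left n m)))
  obtain ⟨m, hm⟩ := isCompact_univ.elim_directed_cover (fun m => (H (max n m) : Set A)) hopen
    (fun x _ => by
      obtain ⟨k, hk⟩ := hU x
      exact Set.mem_iUnion.2 ⟨k, hmono (le_max_right n k) hk⟩)
    (Monotone.directed_le fun i j hij => hmono (max_le_max_left n hij))
  exact ⟨max n m, top_unique fun x _ => hm (Set.mem_univ x)⟩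

/-- On a countable vertex set, a subgroup of chains containing the pointwise sums of its locally
finite sequences is closed. -/
theorem isClosed_of_finsum_mem [Countable V] (H : AddSubgroup (V → V → ZMod 2))
    (hH : ∀ F : ℕ → V → V → ZMod 2, (∀ i, F i ∈ H) → (∀ a b, {i | F i a b ≠ 0}.Finite) →
      (fun a b => ∑ᶠ i, F i a b) ∈ H) : IsClosed (H : Set (V → V → ZMod 2)) := by
  refine isClosed_of_closure_subset fun f hf => ?_
  obtain ⟨x, hx, hlim⟩ := mem_closure_iff_seq_limit.1 hf
  have hev : ∀ a b, ∃ N, ∀ n ≥ N, x n a b = f a b := fun a b => by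
    have h := tendsto_pi_nhds.1 (tendsto_pi_nhds.1 hlim a) b
    rw [nhds_discrete, tendsto_pure] at h
    exact eventually_atTop.1 h
  let F : ℕ → V → V → ZMod 2 := fun n => if n = 0 then x 0 else x n - x (n - 1)
  have hsum : ∀ n, ∑ i ∈ Finset.range (n + 1), F i = x n := fun n => by
    induction n with
    | zero => simp [F]
    | succ n ih => rw [Finset.sum_range_succ, ih]; simp [F]
  have hzero : ∀ a b N, (∀ n ≥ N, x n a b = f a b) → ∀ i, F i a b ≠ 0 → i < N + 1 := by
    intro a b N hN i hi
    by_contra h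
    refine hi ?_
    have h0 : i ≠ 0 := by omega
    simp only [F, if_neg h0, Pi.sub_apply]
    rw [hN i (by omega), hN (i - 1) (by omega), sub_self]
  have hmem := hH F
    (fun i => by
      by_cases h : i = 0
      · simpa [F, h] using hx 0
      · simpa [F, h] using H.sub_mem (hx i) (hx (i - 1)))
    (fun a b => by
      obtain ⟨N, hN⟩ := hev a b
      exact (Set.finite_lt_nat (N + 1)).subset (hzero a b N hN))
  convert! hmem using 1
  funext a b
  obtain ⟨N, hN⟩ := hev a b
  rw [finsum_eq_sum_of_support_subset _ (s := Finset.range (N + 1))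
    (fun i hi => by simpa using hzero a b N hN i hi), ← hN N le_rfl, ← hsum N, Finset.sum_apply,
    Finset.sum_apply]

end Topological

section Finiteness

variable {G : SimpleGraph V}

theorem finite_walks_length_eq (hfin : ∀ v, (G.neighborSet v).Finite) (n : ℕ) (u : V) :
    {p : Σ w, G.Walk u w | p.2.length = n}.Finite := by
  induction n generalizing u with
  | zero =>
    refine (Set.finite_singleton (⟨u, .nil⟩ : Σ w, G.Walk u w)).subset ?_
    rintro ⟨w, p⟩ hp
    cases p with
    | nil => rfl
    | cons h q => simp at hp
  | succ n ih =>
    have := (hfin u).to_subtype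
    refine (Set.finite_iUnion fun v : G.neighborSet u => (ih v).image
      fun q : Σ w, G.Walk v w => (⟨q.1, .cons v.2 q.2⟩ : Σ w, G.Walk u w)).subset ?_
    rintro ⟨w, p⟩ hp
    cases p with
    | nil => simp at hp
    | cons h q =>
      refine Set.mem_iUnion.2 ⟨⟨_, h⟩, ⟨_, q⟩, ?_, rfl⟩
      simpa using hp

theorem finite_walks_length_le (hfin : ∀ v, (G.neighborSet v).Finite) (n : ℕ) (u : V) :
    {p : Σ w, G.Walk u w | p.2.length ≤ n}.Finite := by
  refine ((Set.finite_le_nat n).biUnion fun m _ => finite_walks_length_eq hfin m u).subset ?_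
  intro p hp
  exact Set.mem_biUnion (show p.2.length ∈ {m | m ≤ n} from hp) rfl

theorem countable_of_connected (hfin : ∀ v, (G.neighborSet v).Finite) (hconn : G.Connected) :
    Countable V := by
  obtain ⟨u⟩ := hconn.nonempty
  refine Set.countable_univ_iff.1 ((Set.countable_iUnion fun n =>
    ((finite_walks_length_eq hfin n u).image Sigma.fst).countable).mono ?_)
  intro w _
  obtain ⟨p⟩ := hconn u w
  exact Set.mem_iUnion.2 ⟨p.length, ⟨w, p⟩, rfl, rfl⟩

theorem finite_circuits_through (hfin : ∀ v, (G.neighborSet v).Finite) (R : ℕ) (a b : V) :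
    {c : Circuit G | c.2.length ≤ R ∧ OnWalk c.2 a b}.Finite := by
  refine (((finite_walks_length_le hfin R a).image Sigma.fst).biUnion fun v _ =>
    (((finite_walks_length_le hfin R v).preimage
      (sigma_mk_injective (i := v)).injOn).image fun q => (⟨v, q⟩ : Circuit G))).subset ?_
  rintro ⟨v, p⟩ ⟨hp, i, hi, h⟩
  refine Set.mem_biUnion (x := v) ?_ ⟨p, hp, rfl⟩
  have hlen : ∀ j, (p.take j).length ≤ R := fun j =>
    (p.take_length j).trans_le (min_le_right _ _) |>.trans hp
  obtain ⟨rfl, -⟩ | ⟨-, rfl⟩ := h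
  · exact ⟨⟨v, (p.take i).reverse⟩,
      (SimpleGraph.Walk.length_reverse _).trans_le (hlen i), rfl⟩
  · exact ⟨⟨v, (p.take (i + 1)).reverse⟩,
      (SimpleGraph.Walk.length_reverse _).trans_le (hlen (i + 1)), rfl⟩

end Finiteness

section Walks

variable {G : SimpleGraph V}

theorem onWalk_of_traversals_ne_zero {u v : V} {p : G.Walk u v} {a b : V}
    (h : traversals p a b ≠ 0) : OnWalk p a b := by
  obtain ⟨i, hi⟩ := Finset.card_ne_zero.1 h
  rw [Finset.mem_filter, Finset.mem_range] at hi
  exact ⟨i, hi.1, .inl hi.2⟩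

theorem OnWalk.symm {u v : V} {p : G.Walk u v} {a b : V} (h : OnWalk p a b) : OnWalk p b a := by
  obtain ⟨i, hi, h⟩ := h
  exact ⟨i, hi, h.symm⟩

theorem onWalk_of_walkChainZ2_ne_zero {u v : V} {p : G.Walk u v} {a b : V}
    (h : walkChainZ2 p a b ≠ 0) : OnWalk p a b := by
  by_contra hn
  have h₁ : traversals p a b = 0 := by_contra fun h => hn (onWalk_of_traversals_ne_zero h)
  have h₂ : traversals p b a = 0 := by_contra fun h => hn (onWalk_of_traversals_ne_zero h).symm
  exact h (by simp [walkChainZ2, h₁, h₂])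

theorem OnWalk.adj {u v : V} {p : G.Walk u v} {a b : V} (h : OnWalk p a b) : G.Adj a b := by
  obtain ⟨i, hi, ⟨rfl, rfl⟩ | ⟨rfl, rfl⟩⟩ := h
  · exact p.adj_getVert_succ hi
  · exact (p.adj_getVert_succ hi).symm

/-- A closed walk enters a vertex as often as it leaves it. -/
theorem sum_walkChainZ2 {u v : V} (p : G.Walk u u) (N : Finset V) (hN : ∀ w, G.Adj w v → w ∈ N) :
    ∑ w ∈ N, walkChainZ2 p w v = 0 := by
  have hin : ∑ w ∈ N, traversals p w v
      = ∑ i ∈ Finset.range p.length, if p.getVert (i + 1) = v then 1 else 0 := by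
    simp_rw [traversals, Finset.card_filter]
    rw [Finset.sum_comm]
    refine Finset.sum_congr rfl fun i hi => ?_
    by_cases h : p.getVert (i + 1) = v
    · have : p.getVert i ∈ N := hN _ (h ▸ p.adj_getVert_succ (Finset.mem_range.1 hi))
      simp [h, this]
    · simp [h]
  have hout : ∑ w ∈ N, traversals p v w
      = ∑ i ∈ Finset.range p.length, if p.getVert i = v then 1 else 0 := by
    simp_rw [traversals, Finset.card_filter]
    rw [Finset.sum_comm]
    refine Finset.sum_congr rfl fun i hi => ?_
    by_cases h : p.getVert i = v
    · have : p.getVert (i + 1) ∈ N :=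
        hN _ (h ▸ (p.adj_getVert_succ (Finset.mem_range.1 hi)).symm)
      simp [h, this]
    · simp [h]
  have hEq : ∑ w ∈ N, traversals p w v = ∑ w ∈ N, traversals p v w := by
    have h₁ := Finset.sum_range_succ (fun i => if p.getVert i = v then 1 else 0) p.length
    have h₂ := Finset.sum_range_succ' (fun i => if p.getVert i = v then 1 else 0) p.length
    rw [p.getVert_length] at h₁
    rw [p.getVert_zero] at h₂
    rw [hin, hout]
    omega
  simp_rw [walkChainZ2]
  rw [Finset.sum_add_distrib, ← Nat.cast_sum, ← Nat.cast_sum, hEq]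
  exact CharTwo.add_self_eq_zero _

end Walks

section Spans

variable {G : SimpleGraph V}

/-- The sum map on coefficient families, restricted to circuits of length at most `R`. -/
noncomputable def circSumHom (hfin : ∀ v, (G.neighborSet v).Finite) (R : ℕ) :
    (Circuit G → ZMod 2) →+ (V → V → ZMod 2) where
  toFun g a b := ∑ c ∈ (finite_circuits_through hfin R a b).toFinset, g c * walkChainZ2 c.2 a b
  map_zero' := by funext a b; simp
  map_add' g h := by funext a b; simp [add_mul, Finset.sum_add_distrib]

theorem circSumHom_eq_circSumZ2 (hfin : ∀ v, (G.neighborSet v).Finite) {R : ℕ}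
    {g : Circuit G → ZMod 2} (hg : ∀ c, g c ≠ 0 → c.2.length ≤ R) :
    circSumHom hfin R g = circSumZ2 G g := by
  funext a b
  refine (finsum_eq_sum_of_support_subset _ fun c hc => ?_).symm
  rw [Finset.mem_coe, Set.Finite.mem_toFinset]
  exact ⟨hg c (left_ne_zero_of_mul hc), onWalk_of_walkChainZ2_ne_zero (right_ne_zero_of_mul hc)⟩

theorem coe_range_circSumHom (hfin : ∀ v, (G.neighborSet v).Finite) (R : ℕ) :
    ((circSumHom hfin R).range : Set (V → V → ZMod 2)) = CrZ2 G R := by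
  ext f
  constructor
  · rintro ⟨g, rfl⟩
    have hlen : ∀ c : Circuit G, (if c.2.length ≤ R then g c else 0) ≠ 0 → c.2.length ≤ R :=
      fun c hc => by_contra fun h => hc (if_neg h)
    refine ⟨fun c => if c.2.length ≤ R then g c else 0, hlen,
      fun a b => (finite_circuits_through hfin R a b).subset fun c hc => ⟨hlen c hc.1, hc.2⟩, ?_⟩
    rw [← circSumHom_eq_circSumZ2 hfin hlen]
    funext a b
    refine Finset.sum_congr rfl fun c hc => ?_
    rw [Set.Finite.mem_toFinset] at hc
    simp [hc.1]
  · rintro ⟨g, hg, -, rfl⟩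
    exact ⟨g, circSumHom_eq_circSumZ2 hfin hg⟩

theorem continuous_circSumHom (hfin : ∀ v, (G.neighborSet v).Finite) (R : ℕ) :
    Continuous (circSumHom hfin R) :=
  continuous_pi fun _ => continuous_pi fun _ => continuous_finsetSum _ fun c _ =>
    (continuous_of_discreteTopology (f := fun z : ZMod 2 => z * _)).comp (continuous_apply c)

theorem isClosed_range_circSumHom (hfin : ∀ v, (G.neighborSet v).Finite) (R : ℕ) :
    IsClosed ((circSumHom hfin R).range : Set (V → V → ZMod 2)) :=
  (isCompact_range (continuous_circSumHom hfin R)).isClosed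

theorem CrZ2_mono {R S : ℕ} (h : R ≤ S) : CrZ2 G R ⊆ CrZ2 G S := by
  rintro f ⟨g, hg, ht, rfl⟩
  exact ⟨g, fun c hc => (hg c hc).trans h, ht, rfl⟩

theorem monotone_range_circSumHom (hfin : ∀ v, (G.neighborSet v).Finite) :
    Monotone fun R => (circSumHom hfin R).range := fun R S h => by
  rw [← SetLike.coe_subset_coe, coe_range_circSumHom, coe_range_circSumHom]
  exact CrZ2_mono h

theorem coe_iSup_range_circSumHom (hfin : ∀ v, (G.neighborSet v).Finite) :
    ((⨆ R, (circSumHom hfin R).range : AddSubgroup _) : Set (V → V → ZMod 2)) = CinfZ2 G := by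
  rw [AddSubgroup.coe_iSup_of_directed (monotone_range_circSumHom hfin).directed_le]
  simp_rw [coe_range_circSumHom]
  rfl

theorem walkChainZ2_mem_CrZ2 (hfin : ∀ v, (G.neighborSet v).Finite) (c : Circuit G) :
    (fun a b => walkChainZ2 c.2 a b) ∈ CrZ2 G c.2.length := by
  have hlen : ∀ d : Circuit G, (if d = c then (1 : ZMod 2) else 0) ≠ 0 →
      d.2.length ≤ c.2.length := fun d hd => by
    by_cases h : d = c
    · rw [h]
    · exact absurd (if_neg h) hd
  refine ⟨fun d => if d = c then 1 else 0, hlen, fun a b =>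
    (finite_circuits_through hfin c.2.length a b).subset fun d hd => ⟨hlen d hd.1, hd.2⟩, ?_⟩
  funext a b
  rw [circSumZ2, finsum_eq_single _ c fun d hd => by simp [hd]]
  simp

/-- If every circuit is a sum of circuits of length at most `R`, so is every element of
`CinfZ2 G`. -/
theorem CinfZ2_subset_CrZ2 (hfin : ∀ v, (G.neighborSet v).Finite) {R : ℕ}
    (hR : ∀ c : Circuit G, (fun a b => walkChainZ2 c.2 a b) ∈ CrZ2 G R) :
    CinfZ2 G ⊆ CrZ2 G R := by
  intro f hf
  obtain ⟨r, g, -, ht, rfl⟩ := Set.mem_iUnion.1 hf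
  rw [← coe_range_circSumHom hfin]
  refine finsum_mem_of_isClosed (isClosed_range_circSumHom hfin R)
    (fun c : Circuit G => fun a b => g c * walkChainZ2 c.2 a b) (fun c => ?_) fun a b =>
      (ht a b).subset fun c hc => ⟨left_ne_zero_of_mul hc,
        onWalk_of_walkChainZ2_ne_zero (right_ne_zero_of_mul hc)⟩
  have hc : (fun a b => walkChainZ2 c.2 a b) ∈ (circSumHom hfin R).range := by
    rw [← SetLike.mem_coe, coe_range_circSumHom]
    exact hR c
  obtain h | h : g c = 0 ∨ g c = 1 := by
    generalize g c = z
    revert z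
    decide
  · simp only [h, zero_mul]
    exact zero_mem _
  · simpa only [h, one_mul] using hc

theorem CinfZ2_subset_Zsuf1Z2 (hfin : ∀ v, (G.neighborSet v).Finite) :
    CinfZ2 G ⊆ Zsuf1Z2 G := by
  intro f hf
  obtain ⟨R, g, hg, ht, rfl⟩ := Set.mem_iUnion.1 hf
  have hadj : ∀ u v, circSumZ2 G g u v ≠ 0 → G.Adj u v := fun u v h => by
    obtain ⟨c, hc⟩ := not_forall.1 (mt finsum_eq_zero_of_forall_eq_zero h)
    exact (onWalk_of_walkChainZ2_ne_zero (right_ne_zero_of_mul hc)).adj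
  refine ⟨⟨fun u v => ?_, hadj⟩, fun v => ?_⟩
  · simp only [circSumZ2, walkChainZ2, add_comm]
  · set N := (hfin v).toFinset with hN
    have hmem : ∀ w, G.Adj w v → w ∈ N := fun w h => by simpa [hN] using h.symm
    rw [chainDivZ2, finsum_eq_sum_of_support_subset _ (s := N) fun w hw => hmem w (hadj w v hw)]
    set T := N.biUnion fun w => (ht w v).toFinset with hT
    have hsum : ∀ w ∈ N, circSumZ2 G g w v = ∑ c ∈ T, g c * walkChainZ2 c.2 w v := fun w hw =>
      finsum_eq_sum_of_support_subset _ fun c hc => by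
        rw [Finset.mem_coe, hT, Finset.mem_biUnion]
        exact ⟨w, hw, (ht w v).mem_toFinset.2 ⟨left_ne_zero_of_mul hc,
          onWalk_of_walkChainZ2_ne_zero (right_ne_zero_of_mul hc)⟩⟩
    rw [Finset.sum_congr rfl hsum, Finset.sum_comm]
    refine Finset.sum_eq_zero fun c _ => ?_
    rw [← Finset.mul_sum, sum_walkChainZ2 c.2 N hmem, mul_zero]

/-- If `CinfZ2 G` is closed then it equals some `CrZ2 G R`. -/
theorem exists_CinfZ2_subset_CrZ2 (hfin : ∀ v, (G.neighborSet v).Finite)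
    (hclosed : IsClosed (CinfZ2 G)) : ∃ R, CinfZ2 G ⊆ CrZ2 G R := by
  set K : AddSubgroup (V → V → ZMod 2) := ⨆ R, (circSumHom hfin R).range with hK
  have hKeq : (K : Set (V → V → ZMod 2)) = CinfZ2 G := coe_iSup_range_circSumHom hfin
  have : CompactSpace K := isCompact_iff_compactSpace.1 (hKeq ▸ hclosed.isCompact)
  obtain ⟨R, hR⟩ := exists_eq_top_of_isClosed_of_monotone
    (fun R => (circSumHom hfin R).range.addSubgroupOf K)
    (fun R S h => AddSubgroup.comap_mono (monotone_range_circSumHom hfin h))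
    (fun R => (isClosed_range_circSumHom hfin R).preimage continuous_subtype_val)
    (fun x => (AddSubgroup.mem_iSup_of_directed
      (monotone_range_circSumHom hfin).directed_le).1 x.2)
  refine ⟨R, ?_⟩
  rw [← hKeq, ← coe_range_circSumHom hfin]
  exact AddSubgroup.addSubgroupOf_eq_top.1 hR

end Spans

/-- characterisation of consistency of thin sums in H^uf_1(X,ℤ₂). -/
theorem stmt12 (G : SimpleGraph V) (hulf : ULF G) (hconn : G.Connected) :
    ((∃ R : ℕ, ∀ c : Circuit G, (fun a b => walkChainZ2 c.2 a b) ∈ CrZ2 G R) ↔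
      (∀ F : ℕ → (V → V → ZMod 2), (∀ i, F i ∈ CinfZ2 G) →
        (∀ u v : V, {i : ℕ | F i u v ≠ 0}.Finite) →
        (fun u v => ∑ᶠ i : ℕ, F i u v) ∈ CinfZ2 G)) ∧
    ((∀ F : ℕ → (V → V → ZMod 2), (∀ i, F i ∈ CinfZ2 G) →
        (∀ u v : V, {i : ℕ | F i u v ≠ 0}.Finite) →
        (fun u v => ∑ᶠ i : ℕ, F i u v) ∈ CinfZ2 G) ↔
      (∀ x y : ℕ → (V → V → ZMod 2), (∀ i, x i ∈ Zsuf1Z2 G) → (∀ i, y i ∈ Zsuf1Z2 G) →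
        (∀ u v : V, {i : ℕ | x i u v ≠ 0}.Finite) →
        (∀ u v : V, {i : ℕ | y i u v ≠ 0}.Finite) →
        (∀ i, x i + y i ∈ CinfZ2 G) →
        ((fun u v => ∑ᶠ i : ℕ, x i u v) + fun u v => ∑ᶠ i : ℕ, y i u v) ∈ CinfZ2 G)) := by
  obtain ⟨D, hD⟩ := hulf
  have hfin : ∀ v, (G.neighborSet v).Finite := fun v => (hD v).1
  have := countable_of_connected hfin hconn
  refine ⟨⟨?_, fun h => ?_⟩, fun h x y _ _ hxt hyt hxy => ?_, fun h F hF hFt => ?_⟩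
  · rintro ⟨R, hR⟩ F hF hFt
    refine Set.mem_iUnion.2 ⟨R, ?_⟩
    rw [← coe_range_circSumHom hfin]
    refine finsum_mem_of_isClosed (isClosed_range_circSumHom hfin R) F (fun i => ?_) hFt
    rw [← SetLike.mem_coe, coe_range_circSumHom]
    exact CinfZ2_subset_CrZ2 hfin hR (hF i)
  · have hclosed : IsClosed (CinfZ2 G) := by
      have h' := isClosed_of_finsum_mem (⨆ R, (circSumHom hfin R).range)
      simp only [← SetLike.mem_coe, coe_iSup_range_circSumHom] at h'
      exact h' h
    obtain ⟨R, hR⟩ := exists_CinfZ2_subset_CrZ2 hfin hclosed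
    exact ⟨R, fun c => hR (Set.mem_iUnion.2 ⟨_, walkChainZ2_mem_CrZ2 hfin c⟩)⟩
  · have hsum := h (fun i => x i + y i) hxy fun u v =>
      ((hxt u v).union (hyt u v)).subset (Function.support_add (fun i => x i u v) fun i => y i u v)
    convert! hsum using 1
    funext u v
    exact (finsum_add_distrib (hxt u v) (hyt u v)).symm
  · have hzero : (0 : V → V → ZMod 2) ∈ CinfZ2 G := by
      rw [← coe_iSup_range_circSumHom hfin]
      exact zero_mem _
    have hsum := h F (fun _ => 0) (fun i => CinfZ2_subset_Zsuf1Z2 hfin (hF i))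
      (fun _ => CinfZ2_subset_Zsuf1Z2 hfin hzero) hFt (by simp) (by simpa using hF)
    convert! hsum using 1
    funext u v
    simp

end UFH
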